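/- For every f ∈ F_α and every real number ξ ≥ q one has T_f(qξ) ≤ τ_f(ξ) ≤ T_f(q^{−1}ξ). -/

import Mathlib

open MeasureTheory

/-- C(γ) = 2/π if γ = 1 and (1−γ)/(Γ(2−γ)cos(πγ/2)) otherwise. -/
noncomputable def Cfun (γ : ℝ) : ℝ :=
  if γ = 1 then 2 / Real.pi
  else (1 - γ) / (Real.Gamma (2 - γ) * Real.cos (Real.pi * γ / 2))

/-- T_f(λ) = ∫_ℝ |λ⁻¹ f(x)|^{α(x)} C(α(x)) dx. -/
noncomputable def Tf (α f : ℝ → ℝ) (lam : ℝ) : ℝ :=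
  ∫ x : ℝ, |lam⁻¹ * f x| ^ α x * Cfun (α x)

/-- τ_f(ξ) = ∫_ℝ φ(θ) (∫_ℝ |ξ⁻¹ θ f(x)|^{α(x)} dx) dθ. -/
noncomputable def tauF (α f φ : ℝ → ℝ) (ξ : ℝ) : ℝ :=
  ∫ θ : ℝ, φ θ * (∫ x : ℝ, |ξ⁻¹ * θ * f x| ^ α x)

theorem integral_Ioi_swap_of_nonneg {F : ℝ → ℝ → ℝ} (hF : Measurable (Function.uncurry F))
    (h0 : ∀ x > 0, ∀ t > 0, 0 ≤ F x t)
    (hx : ∀ x > 0, IntegrableOn (F x) (Set.Ioi 0))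
    (ht : ∀ t > 0, IntegrableOn (fun x => F x t) (Set.Ioi 0)) :
    ∫ x in Set.Ioi (0 : ℝ), ∫ t in Set.Ioi (0 : ℝ), F x t =
      ∫ t in Set.Ioi (0 : ℝ), ∫ x in Set.Ioi (0 : ℝ), F x t := by
  have pos : ∀ {p : ℝ → Prop}, (∀ x > 0, p x) → ∀ᵐ x ∂(volume.restrict (Set.Ioi (0 : ℝ))), p x :=
    fun h => ae_restrict_of_forall_mem measurableSet_Ioi h
  have hF' : Measurable (Function.uncurry fun t x => F x t) := hF.comp measurable_swap
  rw [integral_eq_lintegral_of_nonneg_ae, integral_eq_lintegral_of_nonneg_ae]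
  · congr 1
    calc
      _ = ∫⁻ x in Set.Ioi (0 : ℝ), ∫⁻ t in Set.Ioi (0 : ℝ), ENNReal.ofReal (F x t) :=
        lintegral_congr_ae (pos fun x h =>
          ofReal_integral_eq_lintegral_ofReal (hx x h) (pos fun t h' => h0 x h t h'))
      _ = ∫⁻ t in Set.Ioi (0 : ℝ), ∫⁻ x in Set.Ioi (0 : ℝ), ENNReal.ofReal (F x t) :=
        lintegral_lintegral_swap hF.ennreal_ofReal.aemeasurable
      _ = _ := (lintegral_congr_ae (pos fun t h =>
          ofReal_integral_eq_lintegral_ofReal (ht t h) (pos fun x h' => h0 x h' t h))).symm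
  · exact pos fun t h => integral_nonneg_of_ae (pos fun x h' => h0 x h' t h)
  · exact hF'.stronglyMeasurable.integral_prod_right.aestronglyMeasurable
  · exact pos fun x h => integral_nonneg_of_ae (pos fun t h' => h0 x h t h')
  · exact hF.stronglyMeasurable.integral_prod_right.aestronglyMeasurable

theorem sin_pi_mul_half_pos {γ : ℝ} (h0 : 0 < γ) (h2 : γ < 2) :
    0 < Real.sin (Real.pi * γ / 2) :=
  Real.sin_pos_of_pos_of_lt_pi (by positivity) (by nlinarith [Real.pi_pos])

theorem integral_rpow_div_one_add_sq {γ : ℝ} (h0 : 0 < γ) (h2 : γ < 2) :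
    ∫ t in Set.Ioi (0 : ℝ), t ^ (γ - 1) * (1 / (1 + t ^ 2)) =
      Real.pi / (2 * Real.sin (Real.pi * γ / 2)) := by
  have inner_s : ∀ t : ℝ, ∫ s in Set.Ioi (0 : ℝ), t ^ (γ - 1) * Real.exp (-(1 + t ^ 2) * s) =
      t ^ (γ - 1) * (1 / (1 + t ^ 2)) := by
    intro t
    rw [integral_const_mul, integral_exp_mul_Ioi (by nlinarith [sq_nonneg t])]
    rw [mul_zero, Real.exp_zero, neg_div_neg_eq]
  have inner_t : ∀ s > 0, ∫ t in Set.Ioi (0 : ℝ), t ^ (γ - 1) * Real.exp (-(1 + t ^ 2) * s) =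
      (1 / 2 * Real.Gamma (γ / 2)) * (s ^ ((1 - γ / 2) - 1) * Real.exp (-(1 * s))) := by
    intro s hs
    have key := integral_rpow_mul_exp_neg_mul_rpow (p := 2) (q := γ - 1) (by norm_num)
      (by linarith) hs
    calc
      _ = ∫ t in Set.Ioi (0 : ℝ), Real.exp (-(1 * s)) *
          (t ^ (γ - 1) * Real.exp (-s * t ^ (2 : ℝ))) := by
        refine integral_congr_ae (Filter.Eventually.of_forall fun t => ?_)
        simp only [Real.rpow_two]
        rw [mul_left_comm, ← Real.exp_add]
        ring_nf
      _ = _ := by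
        rw [integral_const_mul, key]
        ring_nf
  have hG : 0 < Real.Gamma (γ / 2) := Real.Gamma_pos_of_pos (by linarith)
  have swap := integral_Ioi_swap_of_nonneg
    (F := fun s t => t ^ (γ - 1) * Real.exp (-(1 + t ^ 2) * s))
    (by unfold Function.uncurry; fun_prop)
    (fun s hs t ht => mul_nonneg (Real.rpow_nonneg (le_of_lt ht) _) (Real.exp_pos _).le)
    (fun s hs => Integrable.of_integral_ne_zero (by
      rw [inner_t s hs]
      have := Real.rpow_pos_of_pos hs ((1 - γ / 2) - 1)
      positivity))
    (fun t ht => Integrable.of_integral_ne_zero (by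
      rw [inner_s t]
      have := Real.rpow_pos_of_pos ht (γ - 1)
      positivity))
  simp only [inner_s] at swap
  rw [← swap, setIntegral_congr_fun measurableSet_Ioi inner_t, integral_const_mul,
    Real.integral_rpow_mul_exp_neg_mul_Ioi (by linarith) one_pos]
  have reflection := Real.Gamma_mul_Gamma_one_sub (γ / 2)
  have hs := sin_pi_mul_half_pos h0 h2
  rw [← mul_div_assoc] at reflection
  rw [div_one, Real.one_rpow, one_mul, mul_assoc, reflection]
  field_simp

theorem integral_one_sub_cos_mul_exp {t : ℝ} (ht : 0 < t) :
    IntegrableOn (fun x => (1 - Real.cos x) * Real.exp (-t * x)) (Set.Ioi 0) ∧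
    ∫ x in Set.Ioi (0 : ℝ), (1 - Real.cos x) * Real.exp (-t * x) =
      t⁻¹ * (1 / (1 + t ^ 2)) := by
  have hre : (-t + Complex.I : ℂ).re < 0 := by simpa using ht
  have i1 := integrableOn_exp_mul_Ioi (neg_lt_zero.2 ht) 0
  have i2 := integrableOn_exp_mul_complex_Ioi hre 0
  have e : ∀ x : ℝ, (Complex.exp ((-t + Complex.I) * x)).re = Real.cos x * Real.exp (-t * x) := by
    intro x
    rw [Complex.exp_re]
    simp [mul_comm]
  have i3 : IntegrableOn (fun x => Real.cos x * Real.exp (-t * x)) (Set.Ioi 0) := by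
    simp only [← e]
    exact i2.re
  have v3 : ∫ x in Set.Ioi (0 : ℝ), Real.cos x * Real.exp (-t * x) = t / (1 + t ^ 2) := by
    simp only [← e]
    have := integral_re i2
    simp only [RCLike.re_to_complex] at this
    rw [this, integral_exp_mul_complex_Ioi hre]
    simp [Complex.div_re, Complex.normSq_apply]
    ring
  have split : ∀ x : ℝ, (1 - Real.cos x) * Real.exp (-t * x) =
      Real.exp (-t * x) - Real.cos x * Real.exp (-t * x) := fun x => by ring
  simp only [split]
  refine ⟨i1.sub i3, ?_⟩
  rw [integral_sub i1 i3, v3, integral_exp_mul_Ioi (neg_lt_zero.2 ht)]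
  simp
  field_simp
  ring

theorem integral_one_sub_cos_mul_rpow {γ : ℝ} (h0 : 0 < γ) (h2 : γ < 2) :
    Real.Gamma (γ + 1) * ∫ x in Set.Ioi (0 : ℝ), (1 - Real.cos x) * x ^ (-1 - γ) =
      Real.pi / (2 * Real.sin (Real.pi * γ / 2)) := by
  have inner_t : ∀ x > 0, ∫ t in Set.Ioi (0 : ℝ), t ^ γ * Real.exp (-t * x) =
      Real.Gamma (γ + 1) * x ^ (-1 - γ) := by
    intro x hx
    have key := Real.integral_rpow_mul_exp_neg_mul_Ioi (a := γ + 1) (by linarith) hx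
    rw [show -1 - γ = -(γ + 1) by ring, Real.rpow_neg (le_of_lt hx), mul_comm,
      ← Real.inv_rpow (le_of_lt hx), ← one_div, ← key]
    simp only [add_sub_cancel_right, neg_mul, mul_comm x]
  have hG : 0 < Real.Gamma (γ + 1) := Real.Gamma_pos_of_pos (by linarith)
  have swap := integral_Ioi_swap_of_nonneg
    (F := fun x t => (1 - Real.cos x) * (t ^ γ * Real.exp (-t * x)))
    (by unfold Function.uncurry; fun_prop)
    (fun x hx t ht => mul_nonneg (sub_nonneg.2 (Real.cos_le_one _))
      (mul_nonneg (Real.rpow_nonneg (le_of_lt ht) _) (Real.exp_pos _).le))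
    (fun x hx => Integrable.const_mul (Integrable.of_integral_ne_zero (by
      rw [inner_t x hx]
      have := Real.rpow_pos_of_pos hx (-1 - γ)
      positivity)) _)
    (fun t ht => by
      simp only [mul_left_comm _ (t ^ γ)]
      exact (integral_one_sub_cos_mul_exp ht).1.const_mul (t ^ γ))
  rw [← integral_rpow_div_one_add_sq h0 h2, ← integral_const_mul]
  convert swap using 1
  · refine setIntegral_congr_fun measurableSet_Ioi fun x hx => ?_
    simp only [integral_const_mul]
    rw [inner_t x hx]
    ring
  · refine setIntegral_congr_fun measurableSet_Ioi fun t ht => ?_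
    simp only [mul_left_comm _ (t ^ γ), integral_const_mul]
    rw [(integral_one_sub_cos_mul_exp ht).2, Real.rpow_sub_one (ne_of_gt ht)]
    ring

theorem Cfun_mul_integral {γ : ℝ} (h0 : 0 < γ) (h2 : γ < 2) :
    Cfun γ * (γ * ∫ x in Set.Ioi (0 : ℝ), (1 - Real.cos x) * x ^ (-1 - γ)) = 1 := by
  have key := integral_one_sub_cos_mul_rpow h0 h2
  have hs := sin_pi_mul_half_pos h0 h2
  rw [Real.Gamma_add_one h0.ne'] at key
  set J := ∫ x in Set.Ioi (0 : ℝ), (1 - Real.cos x) * x ^ (-1 - γ)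
  unfold Cfun
  split_ifs with h1
  · subst h1
    simp only [Real.Gamma_one, one_mul, mul_one, Real.sin_pi_div_two] at key ⊢
    rw [key]
    field_simp
  · have hG : 0 < Real.Gamma γ := Real.Gamma_pos_of_pos h0
    have hc : Real.cos (Real.pi * γ / 2) ≠ 0 := by
      intro hc
      rcases lt_or_gt_of_ne h1 with h1 | h1
      · have := Real.cos_pos_of_mem_Ioo (x := Real.pi * γ / 2)
          ⟨by nlinarith [Real.pi_pos], by nlinarith [Real.pi_pos]⟩
        linarith
      · have := Real.cos_neg_of_pi_div_two_lt_of_lt (x := Real.pi * γ / 2)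
          (by nlinarith [Real.pi_pos]) (by nlinarith [Real.pi_pos])
        linarith
    have reflection := Real.Gamma_mul_Gamma_one_sub γ
    rw [show Real.pi * γ = 2 * (Real.pi * γ / 2) by ring, Real.sin_two_mul] at reflection
    have h1' : 1 - γ ≠ 0 := sub_ne_zero.2 (Ne.symm h1)
    have hG2 : Real.Gamma (2 - γ) = (1 - γ) * Real.Gamma (1 - γ) := by
      rw [← Real.Gamma_add_one h1']
      ring_nf
    rw [hG2]
    have hpi := Real.pi_pos
    have hG1 : Real.Gamma (1 - γ) ≠ 0 := by
      intro h
      rw [h, mul_zero] at reflection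
      exact absurd reflection.symm (by positivity)
    generalize Real.sin (Real.pi * γ / 2) = S at *
    generalize Real.cos (Real.pi * γ / 2) = K at *
    have hS := hs.ne'
    field_simp at reflection key ⊢
    have : Real.Gamma γ * (2 * S) ≠ 0 := by positivity
    apply mul_left_cancel₀ this
    linear_combination key - reflection

theorem integral_one_sub_cos_mul_rpow_pos {γ : ℝ} (h0 : 0 < γ) (h2 : γ < 2) :
    0 < ∫ x in Set.Ioi (0 : ℝ), (1 - Real.cos x) * x ^ (-1 - γ) := by
  have hs := sin_pi_mul_half_pos h0 h2
  have hG : 0 < Real.Gamma (γ + 1) := Real.Gamma_pos_of_pos (by linarith)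
  refine pos_of_mul_pos_right (a := Real.Gamma (γ + 1)) ?_ hG.le
  rw [integral_one_sub_cos_mul_rpow h0 h2]
  have := Real.pi_pos
  positivity

theorem Cfun_pos {γ : ℝ} (h0 : 0 < γ) (h2 : γ < 2) : 0 < Cfun γ := by
  have hJ := integral_one_sub_cos_mul_rpow_pos h0 h2
  refine pos_of_mul_pos_left ?_ (mul_pos h0 hJ).le
  rw [Cfun_mul_integral h0 h2]
  exact one_pos

theorem integral_one_sub_cos_mul_mul_rpow {γ : ℝ} (h0 : 0 < γ) (θ : ℝ) :
    ∫ x in Set.Ioi (0 : ℝ), (1 - Real.cos (x * θ)) * x ^ (-1 - γ) =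
      |θ| ^ γ * ∫ x in Set.Ioi (0 : ℝ), (1 - Real.cos x) * x ^ (-1 - γ) := by
  rcases eq_or_ne θ 0 with rfl | hθ
  · simp [Real.zero_rpow h0.ne']
  have hb : 0 < |θ| := abs_pos.2 hθ
  have key := integral_comp_mul_left_Ioi (fun y => (1 - Real.cos y) * y ^ (-1 - γ)) 0 hb
  rw [mul_zero, smul_eq_mul] at key
  have hp : |θ| ^ γ = |θ| ^ (1 + γ) * |θ|⁻¹ := by
    rw [Real.rpow_add hb, Real.rpow_one]
    field_simp
  rw [hp, mul_assoc, ← key, ← integral_const_mul]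
  refine setIntegral_congr_fun measurableSet_Ioi fun x hx => ?_
  have hcos : Real.cos (|θ| * x) = Real.cos (x * θ) := by
    rw [← Real.cos_abs (x * θ), abs_mul, abs_of_pos (Set.mem_Ioi.1 hx), mul_comm]
  have hpow : |θ| ^ (1 + γ) * |θ| ^ (-1 - γ) = 1 := by
    rw [← Real.rpow_add hb]
    simp
  simp only [hcos]
  rw [Real.mul_rpow hb.le (le_of_lt hx)]
  linear_combination (-(1 - Real.cos (x * θ)) * x ^ (-1 - γ)) * hpow

theorem integrableOn_one_sub_cos_mul_mul_rpow {γ : ℝ} (h0 : 0 < γ) (h2 : γ < 2) (θ : ℝ) :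
    IntegrableOn (fun x => (1 - Real.cos (x * θ)) * x ^ (-1 - γ)) (Set.Ioi 0) := by
  rcases eq_or_ne θ 0 with rfl | hθ
  · simp
  refine Integrable.of_integral_ne_zero ?_
  rw [integral_one_sub_cos_mul_mul_rpow h0]
  have := integral_one_sub_cos_mul_rpow_pos h0 h2
  have hb : 0 < |θ| := abs_pos.2 hθ
  positivity

theorem integral_mul_abs_rpow_eq {γ : ℝ} (h0 : 0 < γ) (h2 : γ < 2) {φ ψ : ℝ → ℝ}
    (hφ : Integrable φ) (hm : Integrable fun θ => |θ| ^ γ * |φ θ|)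
    (hψ : ∀ x, ψ x = ∫ θ, φ θ * Real.cos (x * θ)) :
    IntegrableOn (fun x => (ψ 0 - ψ x) * x ^ (-1 - γ)) (Set.Ioi 0) ∧
    ∫ θ, φ θ * |θ| ^ γ = Cfun γ * (γ * ∫ x in Set.Ioi (0 : ℝ), (ψ 0 - ψ x) * x ^ (-1 - γ)) := by
  have hcos : ∀ x, Integrable fun θ => φ θ * Real.cos (x * θ) := fun x =>
    hφ.mul_bdd (c := 1) (by fun_prop)
      (Filter.Eventually.of_forall fun θ => Real.abs_cos_le_one _)
  have hF : Integrable (Function.uncurry fun θ x : ℝ =>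
      φ θ * ((1 - Real.cos (x * θ)) * x ^ (-1 - γ)))
      (volume.prod (volume.restrict (Set.Ioi 0))) := by
    refine (integrable_prod_iff ?_).2 ⟨?_, ?_⟩
    · refine AEStronglyMeasurable.mul hφ.aestronglyMeasurable.comp_fst ?_
      exact Measurable.aestronglyMeasurable (by fun_prop)
    · exact Filter.Eventually.of_forall fun θ =>
        (integrableOn_one_sub_cos_mul_mul_rpow h0 h2 θ).const_mul (φ θ)
    · refine (hm.mul_const (∫ x in Set.Ioi (0 : ℝ), (1 - Real.cos x) * x ^ (-1 - γ))).congr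
        (Filter.Eventually.of_forall fun θ => ?_)
      simp only [Function.uncurry]
      rw [mul_right_comm, ← integral_one_sub_cos_mul_mul_rpow h0, mul_comm, ← integral_const_mul]
      refine setIntegral_congr_fun measurableSet_Ioi fun x hx => ?_
      simp only [norm_mul, Real.norm_eq_abs]
      rw [abs_of_nonneg (sub_nonneg.2 (Real.cos_le_one _)),
        abs_of_nonneg (Real.rpow_nonneg (le_of_lt hx) _)]
  have inner : ∀ x, ∫ θ, φ θ * ((1 - Real.cos (x * θ)) * x ^ (-1 - γ)) =
      (ψ 0 - ψ x) * x ^ (-1 - γ) := by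
    intro x
    rw [hψ, hψ, ← integral_sub (hcos 0) (hcos x), ← integral_mul_const]
    refine integral_congr_ae (Filter.Eventually.of_forall fun θ => ?_)
    simp only [zero_mul, Real.cos_zero]
    ring
  refine ⟨?_, ?_⟩
  · have := hF.integral_prod_right
    simpa only [Function.uncurry, inner] using! this
  · have swap := integral_integral_swap hF
    simp only [inner, integral_const_mul, integral_one_sub_cos_mul_mul_rpow h0] at swap
    rw [← swap]
    simp only [← mul_assoc (φ _), integral_mul_const]
    linear_combination -(∫ θ, φ θ * |θ| ^ γ) * Cfun_mul_integral h0 h2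

theorem integral_mul_abs_rpow_bounds {γ q : ℝ} (h0 : 0 < γ) (h2 : γ < 2) (hq : 1 < q)
    {φ ψ : ℝ → ℝ} (hφ : Integrable φ) (hm : Integrable fun θ => |θ| ^ γ * |φ θ|)
    (hψ : ∀ x, ψ x = ∫ θ, φ θ * Real.cos (x * θ))
    (h01 : ∀ x, ψ x ∈ Set.Icc (0 : ℝ) 1) (h1 : ∀ x, |x| ≤ 1 → ψ x = 1)
    (hzero : ∀ x, q ≤ x → ψ x = 0) :
    q⁻¹ ^ γ * Cfun γ ≤ ∫ θ, φ θ * |θ| ^ γ ∧ ∫ θ, φ θ * |θ| ^ γ ≤ Cfun γ := by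
  obtain ⟨hi, he⟩ := integral_mul_abs_rpow_eq h0 h2 hφ hm hψ
  have hψ0 : ψ 0 = 1 := h1 0 (by simp)
  rw [hψ0] at hi he
  have tail : ∀ c : ℝ, 1 ≤ c → IntegrableOn (fun x : ℝ => x ^ (-1 - γ)) (Set.Ioi c) ∧
      γ * ∫ x in Set.Ioi c, x ^ (-1 - γ) = c⁻¹ ^ γ := by
    intro c hc
    refine ⟨integrableOn_Ioi_rpow_of_lt (by linarith) (by linarith), ?_⟩
    rw [integral_Ioi_rpow_of_lt (by linarith) (by linarith), Real.inv_rpow (by linarith),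
      ← Real.rpow_neg (by linarith), show -1 - γ + 1 = -γ by ring]
    field_simp
  have nonneg : ∀ x ∈ Set.Ioi (0 : ℝ), 0 ≤ (1 - ψ x) * x ^ (-1 - γ) := fun x hx =>
    mul_nonneg (sub_nonneg.2 (h01 x).2) (Real.rpow_nonneg (le_of_lt hx) _)
  have hC := Cfun_pos h0 h2
  rw [he]
  constructor
  · rw [mul_comm, ← (tail q hq.le).2]
    gcongr
    calc
      _ = ∫ x in Set.Ioi q, (1 - ψ x) * x ^ (-1 - γ) :=
        setIntegral_congr_fun measurableSet_Ioi fun x hx => by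
          simp [hzero x (le_of_lt hx)]
      _ ≤ _ := setIntegral_mono_set hi (ae_restrict_of_forall_mem measurableSet_Ioi nonneg)
          (Set.Ioi_subset_Ioi (by linarith)).eventuallyLE
  · refine mul_le_of_le_one_right hC.le ?_
    have h := (tail 1 le_rfl).2
    rw [inv_one, Real.one_rpow] at h
    refine (mul_le_mul_of_nonneg_left ?_ h0.le).trans_eq h
    calc
      _ = ∫ x in Set.Ioi (1 : ℝ), (1 - ψ x) * x ^ (-1 - γ) := by
        refine setIntegral_eq_of_subset_of_forall_sdiff_eq_zero measurableSet_Ioi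
          (Set.Ioi_subset_Ioi (zero_le_one' ℝ)) fun x hx => ?_
        rw [h1 x (by rw [abs_of_pos hx.1]; exact not_lt.1 hx.2), sub_self, zero_mul]
      _ ≤ _ := by
        refine setIntegral_mono_on (hi.mono_set (Set.Ioi_subset_Ioi zero_le_one))
          (tail 1 le_rfl).1 measurableSet_Ioi fun x hx => ?_
        have hx0 : (0 : ℝ) < x := lt_trans one_pos hx
        exact mul_le_of_le_one_left (Real.rpow_nonneg hx0.le _) (by linarith [(h01 x).1])

theorem measurable_Cfun_comp {α : ℝ → ℝ} (hα : Measurable α) (h0 : ∀ x, 0 < α x)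
    (h2 : ∀ x, α x < 2) : Measurable fun x => Cfun (α x) := by
  have hJ : Measurable fun x => ∫ t in Set.Ioi (0 : ℝ), (1 - Real.cos t) * t ^ (-1 - α x) := by
    refine (StronglyMeasurable.integral_prod_right (f := fun x t : ℝ =>
      (1 - Real.cos t) * t ^ (-1 - α x)) ?_).measurable
    exact Measurable.stronglyMeasurable (by unfold Function.uncurry; fun_prop)
  have heq : (fun x => Cfun (α x)) = fun x =>
      (α x * ∫ t in Set.Ioi (0 : ℝ), (1 - Real.cos t) * t ^ (-1 - α x))⁻¹ :=
    funext fun x => eq_inv_of_mul_eq_one_left (Cfun_mul_integral (h0 x) (h2 x))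
  rw [heq]
  exact (hα.mul hJ).inv

theorem eq_integral_mul_cos_of_fourier {φ : ℝ → ℝ} (hφ : Integrable φ) {x y : ℝ}
    (h : (y : ℂ) = ∫ θ : ℝ, Complex.exp (-(Complex.I * x * θ)) * (φ θ : ℂ)) :
    y = ∫ θ, φ θ * Real.cos (x * θ) := by
  have hi : Integrable fun θ : ℝ => Complex.exp (-(Complex.I * x * θ)) * (φ θ : ℂ) := by
    refine hφ.ofReal.bdd_mul (c := 1) (by fun_prop) (Filter.Eventually.of_forall fun θ => ?_)
    rw [Complex.norm_exp]
    simp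
  have hre := integral_re hi
  simp only [RCLike.re_to_complex] at hre
  rw [← h, Complex.ofReal_re] at hre
  rw [← hre]
  refine integral_congr_ae (Filter.Eventually.of_forall fun θ => ?_)
  simp [Complex.exp_re, mul_comm]

/-- for every f ∈ F_α and ξ ≥ q, T_f(qξ) ≤ τ_f(ξ) ≤ T_f(q⁻¹ξ). -/
theorem tau_between_Tf
    (a b : ℝ) (ha : 0 < a) (hab : a < b) (hb : b < 2)
    (α : ℝ → ℝ) (hαm : Measurable α) (hα : ∀ x, α x ∈ Set.Icc a b)
    (q : ℝ) (hq1 : 1 < q)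
    (φ : ℝ → ℝ) (hφeven : ∀ θ, φ (-θ) = φ θ) (hφint : Integrable φ)
    (hφmom : ∀ γ ∈ Set.Ico (0 : ℝ) 4, Integrable (fun θ : ℝ => (1 + |θ|) ^ γ * |φ θ|))
    (φhat : ℝ → ℝ)
    (hφhat : ∀ x : ℝ, (φhat x : ℂ) = ∫ θ : ℝ, Complex.exp (-(Complex.I * x * θ)) * (φ θ : ℂ))
    (hφhat01 : ∀ x, φhat x ∈ Set.Icc (0 : ℝ) 1)
    (hφhat1 : ∀ x : ℝ, |x| ≤ 1 → φhat x = 1)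
    (hφhat0 : ∀ x : ℝ, (1 + q) / 2 ≤ |x| → φhat x = 0)
    (f : ℝ → ℝ) (hfm : Measurable f) (hfi : Integrable (fun x => |f x| ^ α x))
    (ξ : ℝ) (hξ : q ≤ ξ) :
    Tf α f (q * ξ) ≤ tauF α f φ ξ ∧ tauF α f φ ξ ≤ Tf α f (q⁻¹ * ξ) := by
  have hα0 : ∀ x, 0 < α x := fun x => ha.trans_le (hα x).1
  have hα2 : ∀ x, α x < 2 := fun x => (hα x).2.trans_lt hb
  have hq0 : 0 < q := one_pos.trans hq1
  have hξ1 : 1 < ξ := hq1.trans_le hξ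
  have hξ0 : 0 < ξ := one_pos.trans hξ1
  have hpow_le : ∀ x θ : ℝ, |θ| ^ α x ≤ (1 + |θ|) ^ b := fun x θ =>
    (Real.rpow_le_rpow (abs_nonneg θ) (by linarith) (hα0 x).le).trans
      (Real.rpow_le_rpow_of_exponent_le (by linarith [abs_nonneg θ]) (hα x).2)
  have hmom := hφmom b ⟨by linarith, by linarith⟩
  have hmα : ∀ x, Integrable fun θ => |θ| ^ α x * |φ θ| := by
    intro x
    refine hmom.mono' (AEStronglyMeasurable.mul
      (Measurable.aestronglyMeasurable (by fun_prop)) hφint.abs.aestronglyMeasurable)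
      (Filter.Eventually.of_forall fun θ => ?_)
    rw [Real.norm_of_nonneg (by positivity)]
    gcongr
    exact hpow_le x θ
  have bounds : ∀ x, q⁻¹ ^ α x * Cfun (α x) ≤ ∫ θ, φ θ * |θ| ^ α x ∧
      ∫ θ, φ θ * |θ| ^ α x ≤ Cfun (α x) := fun x =>
    integral_mul_abs_rpow_bounds (hα0 x) (hα2 x) hq1 hφint (hmα x)
      (fun y => eq_integral_mul_cos_of_fourier hφint (hφhat y)) hφhat01 hφhat1
      (fun y hy => hφhat0 y (by rw [abs_of_pos (hq0.trans_le hy)]; linarith))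
  set M : ℝ → ℝ := fun x => ∫ θ, φ θ * |θ| ^ α x with hM
  set W : ℝ → ℝ := fun x => |ξ⁻¹ * f x| ^ α x with hW
  have hWm : Measurable W := by
    have : Measurable fun x => |ξ⁻¹ * f x| := by fun_prop
    exact this.pow hαm
  have hW0 : ∀ x, 0 ≤ W x := fun x => Real.rpow_nonneg (abs_nonneg _) _
  have hWle : ∀ x, W x ≤ |f x| ^ α x := by
    intro x
    refine Real.rpow_le_rpow (abs_nonneg _) ?_ (hα0 x).le
    rw [abs_mul, abs_of_pos (inv_pos.2 hξ0)]
    exact mul_le_of_le_one_left (abs_nonneg _) (inv_le_one_of_one_le₀ hξ1.le)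
  have hΦ : Integrable (Function.uncurry fun θ x : ℝ => φ θ * (|θ| ^ α x * W x))
      (volume.prod volume) := by
    refine (hmom.mul_prod hfi).mono' (AEStronglyMeasurable.mul
      hφint.aestronglyMeasurable.comp_fst
      (Measurable.aestronglyMeasurable (by fun_prop))) (Filter.Eventually.of_forall fun p => ?_)
    simp only [Function.uncurry, norm_mul, Real.norm_eq_abs]
    rw [abs_of_nonneg (hW0 _), abs_of_nonneg (Real.rpow_nonneg (abs_nonneg _) _), ← mul_assoc,
      mul_comm |φ _|]
    gcongr
    · exact hpow_le _ _
    · exact hWle _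
  have inner : ∀ x, ∫ θ, φ θ * (|θ| ^ α x * W x) = M x * W x := by
    intro x
    simp only [← mul_assoc (φ _), integral_mul_const, hM]
  have hτ : tauF α f φ ξ = ∫ x, M x * W x := by
    have swap := integral_integral_swap hΦ
    simp only [inner] at swap
    rw [← swap]
    unfold tauF
    simp only [integral_const_mul]
    congr! 4 with θ
    funext x
    rw [mul_comm ξ⁻¹, mul_assoc, abs_mul, Real.mul_rpow (abs_nonneg _) (abs_nonneg _)]
  have hMW : Integrable fun x => M x * W x := by
    have := hΦ.integral_prod_right
    simpa only [Function.uncurry, inner] using! this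
  have hT : ∀ c : ℝ, 0 < c → Tf α f (c * ξ) = ∫ x, c⁻¹ ^ α x * Cfun (α x) * W x := by
    intro c hc
    unfold Tf
    congr! 2 with x
    rw [mul_inv, mul_assoc, abs_mul, Real.mul_rpow (abs_nonneg _) (abs_nonneg _),
      abs_of_pos (inv_pos.2 hc)]
    ring
  have hCm : Measurable fun x => Cfun (α x) := measurable_Cfun_comp hαm hα0 hα2
  have hlow : Integrable fun x => q⁻¹ ^ α x * Cfun (α x) * W x := by
    refine hMW.mono' (Measurable.aestronglyMeasurable (by fun_prop))
      (Filter.Eventually.of_forall fun x => ?_)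
    have := Cfun_pos (hα0 x) (hα2 x)
    have := hW0 x
    rw [Real.norm_of_nonneg (by positivity)]
    gcongr
    exact (bounds x).1
  have hup : Integrable fun x => q⁻¹⁻¹ ^ α x * Cfun (α x) * W x := by
    refine (hlow.const_mul (q ^ (4 : ℝ))).mono' (Measurable.aestronglyMeasurable (by fun_prop))
      (Filter.Eventually.of_forall fun x => ?_)
    have := Cfun_pos (hα0 x) (hα2 x)
    have := hW0 x
    rw [Real.norm_of_nonneg (by positivity), ← mul_assoc, ← mul_assoc, inv_inv,
      Real.inv_rpow hq0.le, ← Real.rpow_neg hq0.le, ← Real.rpow_add hq0]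
    gcongr
    · exact hq1.le
    · linarith [hα2 x]
  rw [hτ, hT q hq0, hT q⁻¹ (inv_pos.2 hq0)]
  refine ⟨integral_mono hlow hMW fun x => ?_, integral_mono hMW hup fun x => ?_⟩
  · exact mul_le_mul_of_nonneg_right (bounds x).1 (hW0 x)
  · refine mul_le_mul_of_nonneg_right ((bounds x).2.trans ?_) (hW0 x)
    rw [inv_inv]
    exact le_mul_of_one_le_left (Cfun_pos (hα0 x) (hα2 x)).le
      (Real.one_le_rpow hq1.le (hα0 x).le)
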